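/- Let T be a tree on n ≥ 4 vertices in which the number n₂(T) of degree-2 vertices is even, obtained cases aside: then there exists a 3-connected graph G on the same vertex set containing T as a spanning subgraph with exactly ⌈(2·n₁(T) + n₂(T))/2⌉ = n₁(T) + n₂(T)/2 additional edges, in which every leaf of T is incident to exactly two new edges, every degree-2 vertex of T to exactly one new edge, and all other vertices to no new edges. -/

import Mathlib

/-- A simple graph `G` on a finite vertex type is `k`-connected if it has more than `k`
vertices and deleting any set of fewer than `k` vertices leaves a connected graph. -/
def KConnected {V : Type*} [Fintype V] (G : SimpleGraph V) (k : ℕ) : Prop :=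
  k < Fintype.card V ∧
    ∀ s : Finset V, s.card < k → (G.induce {v : V | v ∉ s}).Connected

namespace SimpleGraph

variable {V : Type*}

/-- A predicate that spreads along the edges of a connected induced subgraph spreads over all of
it. -/
theorem Preconnected.induce_propagate {G : SimpleGraph V} {W : Set V}
    (h : (G.induce W).Preconnected) {P : V → Prop}
    (hP : ∀ x ∈ W, ∀ y ∈ W, G.Adj x y → P x → P y) {x y : V} (hx : x ∈ W) (hy : y ∈ W)
    (hPx : P x) : P y := by
  obtain ⟨p⟩ := h ⟨x, hx⟩ ⟨y, hy⟩
  suffices ∀ (a b : W), (G.induce W).Walk a b → P a → P b from this _ _ p hPx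
  intro a b p
  induction p with
  | nil => exact id
  | cons hadj _ ih => exact fun h => ih (hP _ (Subtype.coe_prop _) _ (Subtype.coe_prop _) hadj h)

theorem preconnected_induce_of_propagate {G : SimpleGraph V} {W : Set V}
    (h : ∀ P : V → Prop, (∀ x ∈ W, ∀ y ∈ W, G.Adj x y → (P x ↔ P y)) →
      ∀ x ∈ W, ∀ y ∈ W, P x → P y) : (G.induce W).Preconnected := by
  rintro ⟨x, hx⟩ ⟨y, hy⟩
  have := h (fun v => ∃ hv : v ∈ W, (G.induce W).Reachable ⟨x, hx⟩ ⟨v, hv⟩) (by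
    intro a ha b hb hab
    have hab' : (G.induce W).Adj ⟨a, ha⟩ ⟨b, hb⟩ := hab
    exact ⟨fun ⟨_, h⟩ => ⟨hb, h.trans hab'.reachable⟩,
      fun ⟨_, h⟩ => ⟨ha, h.trans hab'.symm.reachable⟩⟩) x hx y hy ⟨hx, .rfl⟩
  exact this.2

theorem Preconnected.propagate {G : SimpleGraph V} (h : G.Preconnected) {P : V → Prop}
    (hP : ∀ x y, G.Adj x y → P x → P y) {x y : V} (hPx : P x) : P y := by
  obtain ⟨p⟩ := h x y
  induction p with
  | nil => exact hPx
  | cons hadj _ ih => exact ih (hP _ _ hadj hPx)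

theorem IsTree.eq_of_adj_of_dist_lt {T : SimpleGraph V} (hT : T.IsTree) {r v x y : V}
    (hx : T.Adj v x) (hy : T.Adj v y) (hxr : T.dist r x < T.dist r v)
    (hyr : T.dist r y < T.dist r v) : x = y := by
  have key : ∀ z, T.Adj v z → T.dist r z < T.dist r v →
      ∃ p : T.Walk r v, p.IsPath ∧ p.penultimate = z := by
    intro z hz hzr
    obtain ⟨p, hp⟩ := hT.1.exists_walk_length_eq_dist r z
    refine ⟨p.concat hz.symm, Walk.isPath_of_length_eq_dist _ ?_, by simp⟩
    have := hT.dist_eq_dist_add_one_of_adj r hz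
    rw [Walk.length_concat]
    lia
  obtain ⟨p, hp, rfl⟩ := key x hx hxr
  obtain ⟨q, hq, rfl⟩ := key y hy hyr
  rw [(hT.existsUnique_path r v).unique hp hq]

/-- Deleting an edge of a forest separates a connected side of it. -/
theorem IsAcyclic.exists_edge_side {T : SimpleGraph V} (hT : T.IsAcyclic) {x y : V}
    (hxy : T.Adj x y) : ∃ S : Set V, x ∈ S ∧ y ∉ S ∧ (T.induce S).Preconnected ∧
      ∀ a b, T.Adj a b → a ∈ S → b ∉ S → a = x ∧ b = y := by
  have hb := isAcyclic_iff_forall_adj_isBridge.1 hT hxy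
  rw [isBridge_iff] at hb
  set H := T.deleteEdges {s(x, y)} with hH
  have step : ∀ a b, T.Adj a b → H.Reachable x a → H.Reachable x b ∨ (a = x ∧ b = y) := by
    intro a b hab ha
    by_cases he : s(a, b) = s(x, y)
    · rw [Sym2.eq_iff] at he
      rcases he with he | ⟨rfl, rfl⟩
      · exact .inr he
      · exact .inl .rfl
    · exact .inl (ha.trans (Adj.reachable (by simp [hH, hab, he])))
  refine ⟨{v | H.Reachable x v}, .rfl, hb, ?_, fun a b hab ha hb' =>
    (step a b hab ha).resolve_left hb'⟩
  have hreach : ∀ a b, H.Walk a b → ∀ ha : H.Reachable x a, ∃ hb : H.Reachable x b,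
      (T.induce {v | H.Reachable x v}).Reachable ⟨a, ha⟩ ⟨b, hb⟩ := by
    intro a b p
    induction p with
    | nil => exact fun ha => ⟨ha, .rfl⟩
    | cons hadj q ih =>
      intro ha
      obtain ⟨hb, h⟩ := ih (ha.trans hadj.reachable)
      exact ⟨hb, Reachable.trans (Adj.reachable (T.deleteEdges_le _ hadj)) h⟩
  rintro ⟨a, ⟨p⟩⟩ ⟨b, ⟨q⟩⟩
  obtain ⟨_, h1⟩ := hreach _ _ p .rfl
  obtain ⟨_, h2⟩ := hreach _ _ q .rfl
  exact h1.symm.trans h2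

/-- The number of edges between `A` and `B`, as ordered pairs. -/
def edgeCount (G : SimpleGraph V) [DecidableRel G.Adj] (A B : Finset V) : ℕ :=
  ∑ a ∈ A, ∑ b ∈ B, if G.Adj a b then 1 else 0

section edgeCount

variable (G : SimpleGraph V) [DecidableRel G.Adj] {A B C : Finset V}

theorem edgeCount_comm : G.edgeCount A B = G.edgeCount B A := by
  rw [edgeCount, Finset.sum_comm]
  simp only [edgeCount, G.adj_comm]

theorem edgeCount_eq_zero (h : ∀ a ∈ A, ∀ b ∈ B, ¬ G.Adj a b) : G.edgeCount A B = 0 :=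
  Finset.sum_eq_zero fun a ha => Finset.sum_eq_zero fun b hb => if_neg (h a ha b hb)

theorem edgeCount_eq_sum_degree [Fintype V] (h : ∀ a ∈ A, ∀ b, G.Adj a b → b ∈ B) :
    G.edgeCount A B = ∑ a ∈ A, G.degree a := by
  refine Finset.sum_congr rfl fun a ha => ?_
  rw [Finset.sum_boole, ← card_neighborFinset_eq_degree, Nat.cast_id]
  congr 1
  ext b
  simpa using h a ha b

variable [DecidableEq V]

theorem edgeCount_union_left (h : Disjoint A B) :
    G.edgeCount (A ∪ B) C = G.edgeCount A C + G.edgeCount B C :=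
  Finset.sum_union h

theorem edgeCount_union_right (h : Disjoint B C) :
    G.edgeCount A (B ∪ C) = G.edgeCount A B + G.edgeCount A C := by
  rw [edgeCount_comm, edgeCount_union_left G h, edgeCount_comm, G.edgeCount_comm (A := C)]

variable {G}

/-- A nonempty vertex set of a tree spans fewer edges than it has vertices. -/
theorem IsTree.edgeCount_self_le (hT : G.IsTree) (hA : A.Nonempty) :
    G.edgeCount A A + 2 ≤ 2 * A.card := by
  obtain ⟨r⟩ := hT.1.nonempty
  obtain ⟨t, htA, ht⟩ := A.exists_min_image (G.dist r) hA
  set U := (A ×ˢ A).filter fun p => G.Adj p.1 p.2 ∧ G.dist r p.2 < G.dist r p.1 with hU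
  have hcard : U.card + 1 ≤ A.card := by
    rw [← Finset.card_erase_add_one htA]
    refine Nat.succ_le_succ (Finset.card_le_card_of_injOn Prod.fst ?_ ?_)
    · rintro ⟨a, b⟩ hab
      simp only [hU, Finset.coe_filter, Finset.mem_product, Set.mem_ofPred_eq] at hab
      simp only [Finset.coe_erase, Set.mem_sdiff, Finset.mem_coe, Set.mem_singleton_iff]
      refine ⟨hab.1.1, ?_⟩
      rintro rfl
      have := ht b hab.1.2
      lia
    · rintro ⟨a, b⟩ hab ⟨a', b'⟩ hab' (rfl : a = a')
      simp only [hU, Finset.coe_filter, Finset.mem_product, Set.mem_ofPred_eq] at hab hab'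
      rw [hT.eq_of_adj_of_dist_lt hab.2.1 hab'.2.1 hab.2.2 hab'.2.2]
  have hsplit : G.edgeCount A A = U.card + U.card := by
    have h1 : U.card = ∑ a ∈ A, ∑ b ∈ A,
        if G.Adj a b ∧ G.dist r b < G.dist r a then 1 else 0 := by
      rw [hU, Finset.card_filter, Finset.sum_product]
    have h2 : U.card = ∑ a ∈ A, ∑ b ∈ A,
        if G.Adj a b ∧ G.dist r a < G.dist r b then 1 else 0 := by
      rw [h1, Finset.sum_comm]
      simp only [G.adj_comm]
    conv_rhs => lhs; rw [h1]
    rw [h2, ← Finset.sum_add_distrib]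
    refine Finset.sum_congr rfl fun a _ => ?_
    rw [← Finset.sum_add_distrib]
    refine Finset.sum_congr rfl fun b _ => ?_
    by_cases hab : G.Adj a b
    · have := hT.dist_eq_dist_add_one_of_adj r hab
      rcases this with h | h <;> simp [hab, h]
    · simp [hab]
  lia

end edgeCount

/-- In a tree, a nonempty leafless vertex set separated from the rest by at most two vertices
consists of the interior vertices of a path whose ends are these two vertices. -/
theorem IsTree.of_leafless_of_separator_card_le_two [Fintype V] [DecidableEq V]
    {T : SimpleGraph V} [DecidableRel T.Adj] (hT : T.IsTree) {A X : Finset V} (hA : A.Nonempty)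
    (hAX : Disjoint A X) (hX : X.card ≤ 2) (hdeg : ∀ a ∈ A, 2 ≤ T.degree a)
    (hN : ∀ a ∈ A, ∀ b, T.Adj a b → b ∈ A ∪ X) :
    (∀ a ∈ A, T.degree a = 2) ∧ X.card = 2 ∧ (T.induce (A : Set V)).Preconnected := by
  have hs := T.edgeCount_eq_sum_degree hN
  have hge : ∑ a ∈ A, 2 ≤ ∑ a ∈ A, T.degree a := Finset.sum_le_sum hdeg
  have hge' := hge
  rw [Finset.sum_const, smul_eq_mul] at hge
  have hAA := hT.edgeCount_self_le hA
  have hW := hT.edgeCount_self_le (hA.mono (Finset.subset_union_left (s₂ := X)))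
  rw [Finset.card_union_of_disjoint hAX, edgeCount_union_left _ hAX,
    edgeCount_union_right _ hAX, edgeCount_union_right _ hAX, T.edgeCount_comm (A := X)] at hW
  rw [edgeCount_union_right _ hAX] at hs
  refine ⟨?_, by lia, ?_⟩
  · have heq : ∑ a ∈ A, 2 = ∑ a ∈ A, T.degree a := by
      rw [Finset.sum_const, smul_eq_mul]
      lia
    exact fun a ha => ((Finset.sum_eq_sum_iff_of_le hdeg).1 heq a ha).symm
  · classical
    refine preconnected_induce_of_propagate fun P hP x hx y hy hPx => ?_
    by_contra hPy
    have h1 := hT.edgeCount_self_le (A := A.filter P) ⟨x, by simpa using ⟨hx, hPx⟩⟩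
    have h2 := hT.edgeCount_self_le (A := A.filter (¬ P ·)) ⟨y, by simpa using ⟨hy, hPy⟩⟩
    have hdisj : Disjoint (A.filter P) (A.filter (¬ P ·)) := Finset.disjoint_filter_filter_not _ _ _
    have h0 : T.edgeCount (A.filter P) (A.filter (¬ P ·)) = 0 := by
      refine edgeCount_eq_zero _ fun a ha b hb hab => ?_
      rw [Finset.mem_filter] at ha hb
      exact hb.2 ((hP a ha.1 b hb.1 hab).1 ha.2)
    have hc := Finset.card_union_of_disjoint hdisj
    have hsum : T.edgeCount A A = T.edgeCount (A.filter P) (A.filter P) +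
        T.edgeCount (A.filter (¬ P ·)) (A.filter (¬ P ·)) := by
      conv_lhs => rw [← Finset.filter_union_filter_not_eq P A]
      rw [edgeCount_union_left _ hdisj, edgeCount_union_right _ hdisj,
        edgeCount_union_right _ hdisj, h0,
        T.edgeCount_comm (A := A.filter (¬ P ·)) (B := A.filter P), h0]
      lia
    rw [Finset.filter_union_filter_not_eq] at hc
    lia

theorem IsTree.exists_adj_of_mem_separator [Fintype V] [DecidableEq V]
    {T : SimpleGraph V} [DecidableRel T.Adj] (hT : T.IsTree) {A X : Finset V} (hA : A.Nonempty)
    (hAX : Disjoint A X) (hX : X.card ≤ 2) (hdeg : ∀ a ∈ A, 2 ≤ T.degree a)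
    (hN : ∀ a ∈ A, ∀ b, T.Adj a b → b ∈ A ∪ X) {x : V} (hx : x ∈ X) :
    ∃ a ∈ A, T.Adj a x := by
  by_contra! h
  have hc := Finset.card_erase_add_one hx
  have := hT.of_leafless_of_separator_card_le_two (X := X.erase x) hA
    (hAX.mono_right (Finset.erase_subset _ _)) (by lia) hdeg (fun a ha b hab => by
      have := hN a ha b hab
      have hbx : b ≠ x := by
        rintro rfl
        exact h a ha hab
      simpa [hbx] using this)
  lia

end SimpleGraph

/-- A finite type can be enumerated in increasing order of an injective key. -/
theorem exists_equiv_fin_strictMono {α β : Type*} [Fintype α] [LinearOrder β] {f : α → β}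
    (hf : Function.Injective f) : ∃ e : Fin (Fintype.card α) ≃ α, StrictMono (f ∘ e) := by
  let e₀ := (Fintype.equivFin α).symm
  refine ⟨(Tuple.sort (f ∘ e₀)).trans e₀, ?_⟩
  exact (Tuple.monotone_sort (f ∘ e₀)).strictMono_of_injective
    (hf.comp ((Tuple.sort (f ∘ e₀)).trans e₀).injective)

namespace SimpleGraph

variable {V : Type*}

theorem IsTree.exists_parent {T : SimpleGraph V} (hT : T.IsTree) (r : V) :
    ∃ π : V → V, π r = r ∧ ∀ v, v ≠ r → T.Adj v (π v) ∧ T.dist r v = T.dist r (π v) + 1 := by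
  classical
  have h : ∀ v, v ≠ r → ∃ w, T.Adj v w ∧ T.dist r v = T.dist r w + 1 := by
    intro v hv
    obtain ⟨p, hp⟩ := hT.1.exists_walk_length_eq_dist v r
    cases p with
    | nil => exact absurd rfl hv
    | cons hadj q =>
      refine ⟨_, hadj, (hT.dist_eq_dist_add_one_of_adj r hadj).resolve_right fun h => ?_⟩
      have := T.dist_le q
      rw [Walk.length_cons, T.dist_comm] at hp
      rw [T.dist_comm] at this
      lia
  choose! π hπ using h
  exact ⟨Function.update π r r, by simp, fun v hv => by simpa [hv] using hπ v hv⟩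

/-- Vertices of degree two in the same connected component of the subgraph they induce in a
rooted tree lie on a common branch, so they have distinct distances from the root. -/
theorem IsTree.eq_of_reachable_induce_of_dist_eq {T : SimpleGraph V} [T.LocallyFinite]
    (hT : T.IsTree) {r : V} {D : Set V} (hr : r ∉ D) (hD : ∀ v ∈ D, T.degree v = 2)
    {x y : D} (hxy : (T.induce D).Reachable x y) (hdist : T.dist r x = T.dist r y) : x = y := by
  obtain ⟨π, hπr, hπ⟩ := hT.exists_parent r
  have hdistπ : ∀ k v, T.dist r (π^[k] v) = T.dist r v - k := by
    intro k
    induction k with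
    | zero => simp
    | succ k ih =>
      intro v
      rw [Function.iterate_succ_apply, ih]
      by_cases hv : v = r
      · simp [hv, hπr]
      · have := (hπ v hv).2
        lia
  have hpar : ∀ v w, T.Adj v w → w = π v ∨ (w ≠ r ∧ v = π w) := by
    intro v w hvw
    rcases hT.dist_eq_dist_add_one_of_adj r hvw with h | h
    · have hv : v ≠ r := by
        rintro rfl
        simp at h
      have := hπ v hv
      exact .inl (hT.eq_of_adj_of_dist_lt (r := r) hvw this.1 (by lia) (by lia))
    · have hw : w ≠ r := by
        rintro rfl
        simp at h
      have := hπ w hw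
      exact .inr ⟨hw, hT.eq_of_adj_of_dist_lt (r := r) hvw.symm this.1 (by lia) (by lia)⟩
  have hchild : ∀ v ∈ D, ∀ a b, a ≠ r → b ≠ r → π a = v → π b = v → a = b := by
    intro v hv a b ha hb hav hbv
    have hvr : v ≠ r := fun h => hr (h ▸ hv)
    have hd := hD v hv
    rw [← card_neighborFinset_eq_degree] at hd
    by_contra hab
    have ha' := hπ a ha
    have hb' := hπ b hb
    have hv' := hπ v hvr
    rw [hav] at ha'
    rw [hbv] at hb'
    classical
    have hsub : ({π v, a, b} : Finset V) ⊆ T.neighborFinset v := by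
      intro z hz
      simp only [Finset.mem_insert, Finset.mem_singleton] at hz
      rw [mem_neighborFinset]
      rcases hz with rfl | rfl | rfl
      exacts [hv'.1, ha'.1.symm, hb'.1.symm]
    have hc := Finset.card_le_card hsub
    rw [hd, Finset.card_eq_three.2 ⟨π v, a, b, ?_, ?_, hab, rfl⟩] at hc
    · lia
    · intro h
      rw [← h] at ha'
      lia
    · intro h
      rw [← h] at hb'
      lia
  obtain ⟨p⟩ := hxy
  have key : ∀ a b : D, (T.induce D).Walk a b →
      ∃ k, (a : V) = π^[k] b ∨ (b : V) = π^[k] a := by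
    intro a b p
    induction p with
    | nil => exact ⟨0, by simp⟩
    | @cons a c b hadj _ ih =>
      have hadj' : T.Adj (a : V) c := hadj
      have har : (a : V) ≠ r := fun h => hr (h ▸ a.2)
      have hcr : (c : V) ≠ r := fun h => hr (h ▸ c.2)
      obtain ⟨k, hk | hk⟩ := ih
      · rcases hpar _ _ hadj' with h | h
        · cases k with
          | zero => exact ⟨1, .inr (by simpa [← h] using hk.symm)⟩
          | succ k =>
            refine ⟨k, .inl (hchild c c.2 _ _ har ?_ h.symm ?_)⟩
            · intro h'
              rw [Function.iterate_succ_apply', h', hπr] at hk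
              exact hcr hk
            · rw [hk, Function.iterate_succ_apply']
        · exact ⟨k + 1, .inl (by rw [Function.iterate_succ_apply', ← hk, h.2])⟩
      · rcases hpar _ _ hadj' with h | h
        · exact ⟨k + 1, .inr (by rw [Function.iterate_succ_apply, ← h, hk])⟩
        · cases k with
          | zero => exact ⟨1, .inl (by simpa [hk] using h.2)⟩
          | succ k => exact ⟨k, .inr (by rw [h.2, hk, Function.iterate_succ_apply])⟩
  have hpos : 0 < T.dist r x := hT.1.pos_dist_of_ne fun h => hr (h ▸ x.2)
  obtain ⟨k, hk | hk⟩ := key x y p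
  · have := hdistπ k y
    rw [← hk] at this
    obtain rfl : k = 0 := by lia
    exact Subtype.ext hk
  · have := hdistπ k x
    rw [← hk] at this
    obtain rfl : k = 0 := by lia
    exact Subtype.ext hk.symm

/-- The vertices of degree two of a tree can be enumerated in such a way that adjacent ones are
consecutive. -/
theorem IsTree.exists_enum_of_degree_eq_two [Fintype V] [DecidableEq V] {T : SimpleGraph V}
    [DecidableRel T.Adj] (hT : T.IsTree) {D : Finset V} (hD : ∀ v ∈ D, T.degree v = 2) :
    ∃ d : ℕ → V, Set.BijOn d {i | i < D.card} D ∧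
      ∀ i < D.card, ∀ j < D.card, T.Adj (d i) (d j) → j = i + 1 ∨ i = j + 1 := by
  obtain ⟨r, hr⟩ : ∃ r, T.degree r < 2 := by
    by_contra! h
    have := hT.1.nonempty
    have := (hT.of_leafless_of_separator_card_le_two (A := Finset.univ) (X := ∅)
      Finset.univ_nonempty (by simp) (by simp) (by simpa using h) (by simp)).2.1
    simp at this
  have hrD : r ∉ (D : Set V) := fun h => by
    have := hD r h
    lia
  let f : ↥(D : Set V) → ℕ ×ₗ ℕ := fun v => toLex
    ((Fintype.equivFin V (((T.induce (D : Set V)).connectedComponentMk v).out : (D : Set V)) : ℕ),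
      T.dist r v)
  have hcomp : ∀ x y : (D : Set V), (T.induce (D : Set V)).Reachable x y →
      (ofLex (f x)).1 = (ofLex (f y)).1 := by
    intro x y h
    simp only [f, ofLex_toLex, ConnectedComponent.eq.2 h]
  have hcomp' : ∀ x y : (D : Set V), (ofLex (f x)).1 = (ofLex (f y)).1 →
      (T.induce (D : Set V)).Reachable x y := by
    intro x y h
    simp only [f, ofLex_toLex, Fin.val_inj, EmbeddingLike.apply_eq_iff_eq, Subtype.val_inj] at h
    rw [← ConnectedComponent.eq]
    exact (Quot.out_eq _).symm.trans ((congrArg (Quot.mk _) h).trans (Quot.out_eq _))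
  have hf : Function.Injective f := fun x y h =>
    hT.eq_of_reachable_induce_of_dist_eq hrD hD (hcomp' x y (by rw [h]))
      (congrArg (fun z => (ofLex z).2) h)
  obtain ⟨e, he⟩ := exists_equiv_fin_strictMono hf
  have hcard : Fintype.card (D : Set V) = D.card := by simp
  have hlt : ∀ i < D.card, i < Fintype.card (D : Set V) := fun i hi => hcard ▸ hi
  obtain ⟨r'⟩ := hT.1.nonempty
  let d : ℕ → V := fun i => if h : i < Fintype.card (D : Set V) then e ⟨i, h⟩ else r'
  have hd : ∀ i (hi : i < D.card), d i = e ⟨i, hlt i hi⟩ := fun i hi => dif_pos (hlt i hi)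
  have key : ∀ i j : Fin (Fintype.card (D : Set V)), i < j → T.Adj (e i) (e j) →
      (j : ℕ) = i + 1 := by
    intro i j hij hadj
    by_contra hne
    have hk : (i : ℕ) + 1 < j := by
      have : (i : ℕ) < j := hij
      lia
    let k : Fin (Fintype.card (D : Set V)) := ⟨i + 1, hk.trans j.2⟩
    have h1 : f (e i) < f (e k) := he (show (i : ℕ) < i + 1 by lia)
    have h2 : f (e k) < f (e j) := he hk
    have h3 : (ofLex (f (e i))).1 = (ofLex (f (e j))).1 :=
      hcomp _ _ (Adj.reachable (by exact hadj))
    rw [Prod.Lex.lt_iff] at h1 h2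
    have h4 : T.dist r (e i) < T.dist r (e k) := by
      rcases h1 with h1 | h1
      · lia
      · exact h1.2
    have h5 : T.dist r (e k) < T.dist r (e j) := by
      rcases h2 with h2 | h2
      · lia
      · exact h2.2
    have := hT.dist_eq_dist_add_one_of_adj r hadj
    lia
  refine ⟨d, ⟨?_, ?_, ?_⟩, ?_⟩
  · intro i hi
    rw [hd i hi]
    exact Subtype.coe_prop _
  · intro i hi j hj hij
    rw [hd i hi, hd j hj, Subtype.val_inj, e.injective.eq_iff, Fin.mk.injEq] at hij
    exact hij
  · intro v hv
    refine ⟨e.symm ⟨v, hv⟩, hcard ▸ (e.symm ⟨v, hv⟩).2, ?_⟩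
    rw [hd _ (hcard ▸ (e.symm ⟨v, hv⟩).2)]
    simp
  · intro i hi j hj hadj
    rw [hd i hi, hd j hj] at hadj
    rcases lt_trichotomy i j with h | rfl | h
    · exact .inl (key ⟨i, hlt i hi⟩ ⟨j, hlt j hj⟩ h hadj)
    · exact absurd hadj T.irrefl
    · exact .inr (key ⟨j, hlt j hj⟩ ⟨i, hlt i hi⟩ h hadj.symm)

theorem IsTree.degree_pos [Fintype V] {T : SimpleGraph V} [DecidableRel T.Adj] (hT : T.IsTree)
    (hn : 2 ≤ Fintype.card V) (v : V) : 0 < T.degree v := by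
  have : Nontrivial V := Fintype.one_lt_card_iff_nontrivial.1 hn
  exact hT.1.preconnected.degree_pos_of_nontrivial v

/-- A criterion for a supergraph `G` of a tree `T` to be 3-connected, when `G` has a path `l`
through all the leaves of `T`. -/
theorem IsTree.kConnected_three_of_le [Fintype V] [DecidableEq V] {T G : SimpleGraph V}
    [DecidableRel T.Adj] (hT : T.IsTree) (hTG : T ≤ G) (hn : 4 ≤ Fintype.card V) {k : ℕ}
    {l : ℕ → V} (hl : Set.BijOn l {i | i < k} {v | T.degree v = 1})
    (hpath : ∀ i, i + 1 < k → G.Adj (l i) (l (i + 1)))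
    (hends : ∀ X : Finset V, X.card ≤ 2 → (∃ j, 0 < j ∧ j + 1 < k ∧ l j ∈ X) → l 0 ∉ X →
      l (k - 1) ∉ X → ∀ P : V → Prop, (∀ x ∉ X, ∀ y ∉ X, G.Adj x y → (P x ↔ P y)) →
      (P (l 0) ↔ P (l (k - 1))))
    (hthread : ∀ A X : Finset V, A.Nonempty → Disjoint A X → (∀ a ∈ A, T.degree a = 2) →
      X.card = 2 → (T.induce (A : Set V)).Preconnected → (∀ x ∈ X, ∃ a ∈ A, T.Adj a x) →
      (∃ x ∈ X, T.degree x ≠ 1) → ∃ a ∈ A, ∃ b, b ∉ A ∪ X ∧ G.Adj a b) :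
    KConnected G 3 := by
  refine ⟨hn, fun s hs => ?_⟩
  have hne : Nonempty {v : V | v ∉ s} := by
    by_contra! h
    have : Finset.univ ⊆ s := fun v _ => by
      by_contra hv
      exact h.false ⟨v, hv⟩
    have := Finset.card_le_card this
    rw [Finset.card_univ] at this
    lia
  refine ⟨?_⟩
  by_cases hleaf : ∀ z ∈ s, T.degree z = 1
  · refine Preconnected.mono (G := T.induce _) (fun _ _ h => hTG h) ?_
    refine hT.1.preconnected.induce_of_degree_eq_one fun v hv => ?_
    have hv1 := hleaf v (by simpa using hv)
    rw [← card_neighborFinset_eq_degree, Finset.card_eq_one] at hv1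
    obtain ⟨w, hw⟩ := hv1
    rw [← coe_neighborFinset, hw, Finset.coe_singleton]
    exact Set.subsingleton_singleton
  push Not at hleaf
  obtain ⟨z, hzs, hz⟩ := hleaf
  refine preconnected_induce_of_propagate fun P hP x hx y hy hPx => ?_
  by_contra hPy
  have exists_leaf : ∀ Q : V → Prop, (∀ x ∉ s, ∀ y ∉ s, G.Adj x y → (Q x ↔ Q y)) →
      ∀ x ∉ s, Q x → ∃ i < k, l i ∉ s ∧ Q (l i) := by
    classical
    intro Q hQ x hx hQx
    by_contra! hno
    set A := Finset.univ.filter fun v => v ∉ s ∧ Q v with hAdef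
    have hA : A.Nonempty := ⟨x, by simp [hAdef, hx, hQx]⟩
    have hdisj : Disjoint A s := by
      rw [Finset.disjoint_left]
      intro a ha
      simp only [hAdef, Finset.mem_filter] at ha
      exact ha.2.1
    have hdeg : ∀ a ∈ A, 2 ≤ T.degree a := by
      intro a ha
      simp only [hAdef, Finset.mem_filter_univ] at ha
      have := hT.degree_pos (by lia) a
      by_contra h
      obtain ⟨i, hi, rfl⟩ := hl.surjOn (show a ∈ {v | T.degree v = 1} by simp; lia)
      exact hno i hi ha.1 ha.2
    have hN : ∀ a ∈ A, ∀ b, G.Adj a b → b ∈ A ∪ s := by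
      intro a ha b hab
      simp only [hAdef, Finset.mem_filter_univ] at ha
      by_cases hb : b ∈ s
      · exact Finset.mem_union_right _ hb
      · exact Finset.mem_union_left _ (by simp [hAdef, hb, (hQ a ha.1 b hb hab).1 ha.2])
    have hNT : ∀ a ∈ A, ∀ b, T.Adj a b → b ∈ A ∪ s := fun a ha b hab => hN a ha b (hTG hab)
    obtain ⟨h1, h2, h3⟩ :=
      hT.of_leafless_of_separator_card_le_two hA hdisj (by lia) hdeg hNT
    obtain ⟨a, ha, b, hb, hab⟩ := hthread A s hA hdisj h1 h2 h3
      (fun x hx => hT.exists_adj_of_mem_separator hA hdisj (by lia) hdeg hNT hx) ⟨z, hzs, hz⟩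
    exact hb (hN a ha b hab)
  obtain ⟨i, hi, his, hPi⟩ := exists_leaf P hP x hx hPx
  obtain ⟨i', hi', his', hPi'⟩ := exists_leaf (¬ P ·)
    (fun x hx y hy h => not_congr (hP x hx y hy h)) y hy hPy
  have hunique : ∀ i < k, ∀ j < k, l i ∈ s → l j ∈ s → i = j := by
    intro i hi j hj his hjs
    by_contra hij
    have hij' : l i ≠ l j := fun h => hij (hl.injOn hi hj h)
    have hli := hl.mapsTo hi
    have hlj := hl.mapsTo hj
    have hsub : ({z, l i, l j} : Finset V) ⊆ s := by
      intro v hv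
      simp only [Finset.mem_insert, Finset.mem_singleton] at hv
      rcases hv with rfl | rfl | rfl <;> assumption
    have hc := Finset.card_le_card hsub
    rw [Finset.card_eq_three.2 ⟨z, l i, l j, ?_, ?_, hij', rfl⟩] at hc
    · lia
    · rintro rfl
      exact hz hli
    · rintro rfl
      exact hz hlj
  have hseg : ∀ a b, a ≤ b → b < k → (∀ c, a ≤ c → c ≤ b → l c ∉ s) →
      (P (l a) ↔ P (l b)) := by
    intro a b hab
    induction b, hab using Nat.le_induction with
    | base => simp
    | succ b hab ih =>
      intro hb hc
      rw [ih (by lia) fun c h1 h2 => hc c h1 (by lia)]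
      exact hP _ (hc b hab (by lia)) _ (hc _ (by lia) le_rfl) (hpath b hb)
  have hsep : ∀ i i', i ≤ i' → i' < k → l i ∉ s → l i' ∉ s → (P (l i) ↔ P (l i')) := by
    intro i i' hii hik his his'
    by_cases h : ∃ j, i ≤ j ∧ j ≤ i' ∧ l j ∈ s
    · obtain ⟨j, hij, hji, hjs⟩ := h
      have hji' : j ≠ i := by
        rintro rfl
        exact his hjs
      have hji'' : j ≠ i' := by
        rintro rfl
        exact his' hjs
      have hoff : ∀ c < k, c ≠ j → l c ∉ s := fun c hc hcj h =>
        hcj (hunique c hc j (by lia) h hjs)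
      rw [← hseg 0 i (by lia) (by lia) fun c _ _ => hoff c (by lia) (by lia),
        hseg i' (k - 1) (by lia) (by lia) fun c _ _ => hoff c (by lia) (by lia)]
      exact hends s (by lia) ⟨j, by lia, by lia, hjs⟩ (hoff _ (by lia) (by lia))
        (hoff _ (by lia) (by lia)) P hP
    · push Not at h
      exact hseg i i' hii hik h
  rcases le_total i i' with h | h
  · exact hPi' ((hsep i i' h hi' his his').1 hPi)
  · exact hPi' ((hsep i' i h hi his' his).2 hPi)

/-- The graph obtained by transporting a relation on `{i | i < N}` along `g`. -/
def ofIndex (g : ℕ → V) (N : ℕ) (R : ℕ → ℕ → Prop) (hg : Set.InjOn g {i | i < N})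
    (hR : ∀ i j, R i j → R j i) (hR' : ∀ i < N, ¬ R i i) : SimpleGraph V where
  Adj x y := ∃ i < N, ∃ j < N, g i = x ∧ g j = y ∧ R i j
  symm := ⟨fun _ _ ⟨i, hi, j, hj, hx, hy, h⟩ => ⟨j, hj, i, hi, hy, hx, hR i j h⟩⟩
  loopless := ⟨fun _ ⟨i, hi, _, hj, hx, hy, h⟩ => hR' i hi (by
    rwa [← hg hi hj (hx.trans hy.symm)] at h)⟩

section ofIndex

variable {g : ℕ → V} {N : ℕ} {R : ℕ → ℕ → Prop} {hg : Set.InjOn g {i | i < N}}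
  {hR : ∀ i j, R i j → R j i} {hR' : ∀ i < N, ¬ R i i}

theorem ofIndex_adj_iff {i j : ℕ} (hi : i < N) (hj : j < N) :
    (ofIndex g N R hg hR hR').Adj (g i) (g j) ↔ R i j := by
  refine ⟨fun ⟨i', hi', j', hj', hii, hjj, h⟩ => ?_, fun h => ⟨i, hi, j, hj, rfl, rfl, h⟩⟩
  rwa [← hg hi' hi hii, ← hg hj' hj hjj]

theorem ncard_neighborSet_ofIndex {i : ℕ} (hi : i < N) :
    ((ofIndex g N R hg hR hR').neighborSet (g i)).ncard = {j | j < N ∧ R i j}.ncard := by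
  rw [← (hg.mono fun j hj => hj.1 : Set.InjOn g {j | j < N ∧ R i j}).ncard_image]
  congr 1
  ext y
  constructor
  · rintro ⟨i', hi', j, hj, hii, rfl, h⟩
    exact ⟨j, ⟨hj, by rwa [← hg hi' hi hii]⟩, rfl⟩
  · rintro ⟨j, ⟨hj, h⟩, rfl⟩
    exact ⟨i, hi, j, hj, rfl, rfl, h⟩

theorem neighborSet_ofIndex_eq_empty {v : V} (hv : ∀ i < N, g i ≠ v) :
    (ofIndex g N R hg hR hR').neighborSet v = ∅ := by
  ext y
  simp only [mem_neighborSet, Set.mem_empty_iff_false, iff_false]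
  rintro ⟨i, hi, _, _, h, _⟩
  exact hv i hi h

end ofIndex

theorem two_mul_ncard_edgeSet [Fintype V] (F : SimpleGraph V) :
    2 * F.edgeSet.ncard = ∑ v, (F.neighborSet v).ncard := by
  classical
  rw [← coe_edgeFinset, Set.ncard_coe_finset, ← sum_degrees_eq_twice_card_edges]
  refine Finset.sum_congr rfl fun v _ => ?_
  rw [← card_neighborFinset_eq_degree, ← Set.ncard_coe_finset, coe_neighborFinset]

theorem eq_of_adj_of_degree_eq_one {G : SimpleGraph V} {a x y : V} [Fintype (G.neighborSet a)]
    (ha : G.degree a = 1) (hx : G.Adj a x) (hy : G.Adj a y) : x = y := by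
  obtain ⟨z, _, hz⟩ := (G.degree_eq_one_iff_existsUnique_adj).1 ha
  rw [hz x hx, hz y hy]

theorem IsTree.not_adj_of_degree_eq_one [Fintype V] {T : SimpleGraph V} [DecidableRel T.Adj]
    (hT : T.IsTree) (hn : 3 ≤ Fintype.card V) {a b : V} (ha : T.degree a = 1)
    (hb : T.degree b = 1) : ¬ T.Adj a b := by
  classical
  intro hab
  have h : ∀ v, v ∈ ({a, b} : Finset V) := fun v => by
    refine hT.1.preconnected.propagate (P := (· ∈ ({a, b} : Finset V))) ?_
      (Finset.mem_insert_self a {b})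
    intro x y hxy hx
    simp only [Finset.mem_insert, Finset.mem_singleton] at hx ⊢
    rcases hx with rfl | rfl
    · exact .inr (eq_of_adj_of_degree_eq_one ha hxy hab)
    · exact .inl (eq_of_adj_of_degree_eq_one hb hxy hab.symm)
  have := Finset.card_le_card (fun v _ => h v : (Finset.univ : Finset V) ⊆ {a, b})
  have := Finset.card_le_two (a := a) (b := b)
  rw [Finset.card_univ] at *
  lia

theorem Preconnected.induce_diff_of_degree_eq_one {G : SimpleGraph V} {W : Set V} {a : V}
    [Fintype (G.neighborSet a)] (h : (G.induce W).Preconnected) (ha : G.degree a = 1) :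
    (G.induce (W \ {a})).Preconnected := by
  refine preconnected_induce_of_propagate fun P hP x hx y hy hPx => ?_
  suffices (y ≠ a ∧ P y) ∨ (y = a ∧ ∃ u ∈ W, u ≠ a ∧ G.Adj a u ∧ P u) from
    this.elim And.right fun h => absurd h.1 hy.2
  refine h.induce_propagate (P := fun v => (v ≠ a ∧ P v) ∨
    (v = a ∧ ∃ u ∈ W, u ≠ a ∧ G.Adj a u ∧ P u)) ?_ hx.1 hy.1 (.inl ⟨hx.2, hPx⟩)
  rintro u hu v hv huv (⟨hua, hPu⟩ | ⟨rfl, w, hw, hwa, haw, hPw⟩)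
  · by_cases hva : v = a
    · exact .inr ⟨hva, u, hu, hua, hva ▸ huv.symm, hPu⟩
    · exact .inl ⟨hva, (hP u ⟨hu, hua⟩ v ⟨hv, hva⟩ huv).1 hPu⟩
  · rw [eq_of_adj_of_degree_eq_one ha huv haw]
    exact .inl ⟨hwa, hPw⟩

/-- The side of an edge at an endpoint of degree two contains a leaf. -/
theorem IsTree.exists_edge_side_leaf [Fintype V] [DecidableEq V] {T : SimpleGraph V}
    [DecidableRel T.Adj] (hT : T.IsTree) {x y : V} (hxy : T.Adj x y) (hx : T.degree x = 2) :
    ∃ W : Set V, ∃ a ∈ W, T.degree a = 1 ∧ x ∈ W ∧ y ∉ W ∧ (T.induce W).Preconnected ∧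
      ∀ u v, T.Adj u v → u ∈ W → v ∉ W → u = x ∧ v = y := by
  classical
  obtain ⟨W, hxW, hyW, hW, hcross⟩ := hT.2.exists_edge_side hxy
  by_contra! hleaf
  have hdeg : ∀ a ∈ W, T.degree a ≠ 1 := fun a ha h1 => by
    obtain ⟨u, v, huv, hu, hv, h⟩ := hleaf W a ha h1 hxW hyW hW
    exact h (hcross u v huv hu hv).1 (hcross u v huv hu hv).2
  obtain ⟨z, hz, hzy⟩ : ∃ z ∈ T.neighborFinset x, z ≠ y :=
    Finset.exists_mem_ne (by rw [card_neighborFinset_eq_degree]; lia) y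
  rw [mem_neighborFinset] at hz
  have hzW : z ∈ W := by
    by_contra h
    exact hzy (hcross x z hz hxW h).2
  have hcard : 2 ≤ Fintype.card V := by
    have := T.degree_lt_card_verts x
    lia
  have := (hT.of_leafless_of_separator_card_le_two (A := W.toFinset.erase x) (X := {x})
    ⟨z, by simpa [hzW] using hz.ne'⟩ (by simp) (by simp) ?_ ?_).2.1
  · simp at this
  · intro a ha
    have := hdeg a (by simp at ha; exact ha.2)
    have := hT.degree_pos hcard a
    lia
  · intro a ha b hab
    simp only [Finset.mem_erase, Set.mem_toFinset] at ha
    simp only [Finset.mem_union, Finset.mem_erase, Set.mem_toFinset, Finset.mem_singleton]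
    by_cases hb : b ∈ W
    · by_cases h : b = x
      · exact .inr h
      · exact .inl ⟨h, hb⟩
    · exact absurd (hcross a b hab ha.2 hb).1 ha.1

section Enumeration

variable {T : SimpleGraph V} {D : Finset V} {d : ℕ → V}

/-- A connected set of vertices meets a sequence without long edges in an interval. -/
theorem Preconnected.mem_of_le_of_le (hd : Set.BijOn d {i | i < D.card} D)
    (hadj : ∀ i < D.card, ∀ j < D.card, T.Adj (d i) (d j) → j = i + 1 ∨ i = j + 1)
    {A : Set V} (hA : (T.induce A).Preconnected) (hAD : A ⊆ D) {i j h : ℕ} (hij : i ≤ j)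
    (hjh : j ≤ h) (hh : h < D.card) (hi : d i ∈ A) (hhA : d h ∈ A) : d j ∈ A := by
  by_contra hj
  obtain ⟨c, hcj, hc⟩ := hA.induce_propagate (P := fun v => ∃ c < j, d c = v) (by
    rintro _ hx y hy hxy ⟨c, hc, rfl⟩
    obtain ⟨b, hb, rfl⟩ := hd.surjOn (hAD hy)
    refine ⟨b, ?_, rfl⟩
    have h1 := hadj c (by lia) b hb hxy
    have h2 : b ≠ j := by
      rintro rfl
      exact hj hy
    lia) hi hhA ⟨i, lt_of_le_of_ne hij (by rintro rfl; exact hj hi), rfl⟩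
  have := hd.injOn (show c < D.card by lia) hh hc
  lia

theorem Preconnected.adj_succ (hd : Set.BijOn d {i | i < D.card} D)
    (hadj : ∀ i < D.card, ∀ j < D.card, T.Adj (d i) (d j) → j = i + 1 ∨ i = j + 1)
    (hD : (T.induce (D : Set V)).Preconnected) {i : ℕ} (hi : i + 1 < D.card) :
    T.Adj (d i) (d (i + 1)) := by
  by_contra hne
  obtain ⟨c, hci, hc⟩ := hD.induce_propagate (P := fun v => ∃ c ≤ i, d c = v) (by
    rintro _ hx y hy hxy ⟨c, hc, rfl⟩
    obtain ⟨b, hb, rfl⟩ := hd.surjOn hy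
    refine ⟨b, ?_, rfl⟩
    rcases hadj c (by lia) b hb hxy with rfl | rfl
    · by_contra h
      obtain rfl : c = i := by lia
      exact hne hxy
    · lia) (hd.mapsTo (show i < D.card by lia)) (hd.mapsTo (show i + 1 < D.card from hi))
    ⟨i, le_rfl, rfl⟩
  have := hd.injOn (show c < D.card by lia) hi hc
  lia

/-- The two sides of a path of vertices of degree two, each with a leaf. -/
theorem IsTree.exists_leaf_side [Fintype V] [DecidableEq V] [DecidableRel T.Adj]
    (hT : T.IsTree) {n : ℕ} (hd : Set.InjOn d {i | i < n}) (hn : 2 ≤ n)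
    (hadj : ∀ i, i + 1 < n → T.Adj (d i) (d (i + 1))) (h0 : T.degree (d 0) = 2) :
    ∃ W : Set V, ∃ a ∈ W, T.degree a = 1 ∧ d 0 ∈ W ∧ (T.induce W).Preconnected ∧
      (∀ i < n, d i ∈ W → i = 0) ∧
      ∀ u v, T.Adj u v → u ∈ W → v ∉ W → u = d 0 ∧ v = d 1 := by
  obtain ⟨W, a, haW, ha, hxW, hyW, hW, hcross⟩ :=
    hT.exists_edge_side_leaf (hadj 0 (by lia)) h0
  have key : ∀ i, i + 1 < n → d (i + 1) ∉ W := by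
    intro i
    induction i with
    | zero => exact fun _ => hyW
    | succ i ih =>
      intro hi hmem
      have := hd hi (show 0 < n by lia)
        (hcross _ _ (hadj (i + 1) hi).symm hmem (ih (by lia))).1
      lia
  refine ⟨W, a, haW, ha, hxW, hW, fun i hi hiW => ?_, hcross⟩
  by_contra h
  obtain ⟨j, rfl⟩ := Nat.exists_eq_succ_of_ne_zero h
  exact key j hi hiW

end Enumeration

end SimpleGraph

/-- A finite set can be enumerated with prescribed distinct first and last elements. -/
theorem Finset.exists_bijOn_first_last {α : Type*} [DecidableEq α] {S : Finset α} {a b : α}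
    (ha : a ∈ S) (hb : b ∈ S) (hab : a ≠ b) :
    ∃ l : ℕ → α, Set.BijOn l {i | i < S.card} S ∧ l 0 = a ∧ l (S.card - 1) = b := by
  have h2 : 1 < S.card := Finset.one_lt_card.2 ⟨a, ha, b, hb, hab⟩
  let e := S.equivFin.symm
  let z : Fin S.card := ⟨0, by lia⟩
  let w : Fin S.card := ⟨S.card - 1, by lia⟩
  have hzw : z ≠ w := fun h => by
    have := congrArg Fin.val h
    simp only [z, w] at this
    lia
  let f := ((Equiv.swap z (e.symm ⟨a, ha⟩)).trans e)
  have hf : f z = ⟨a, ha⟩ := by simp [f]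
  let g := (Equiv.swap w (f.symm ⟨b, hb⟩)).trans f
  have hgw : g w = ⟨b, hb⟩ := by simp [g]
  have hgz : g z = ⟨a, ha⟩ := by
    have : z ≠ f.symm ⟨b, hb⟩ := fun h => by
      rw [Equiv.eq_symm_apply, hf, Subtype.mk.injEq] at h
      exact hab h
    rw [← hf]
    simp [g, Equiv.swap_apply_of_ne_of_ne hzw this]
  refine ⟨fun i => if h : i < S.card then g ⟨i, h⟩ else a, ⟨?_, ?_, ?_⟩, ?_, ?_⟩
  · intro i hi
    have hi' : i < S.card := hi
    simp [hi']
  · intro i hi j hj hij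
    have hi' : i < S.card := hi
    have hj' : j < S.card := hj
    simp only [hi', hj', dif_pos, Subtype.val_inj, g.injective.eq_iff, Fin.mk.injEq] at hij
    exact hij
  · intro v hv
    refine ⟨g.symm ⟨v, hv⟩, (g.symm ⟨v, hv⟩).2, by simp⟩
  · simpa [z, show 0 < S.card by lia] using congrArg Subtype.val hgz
  · simpa [w, show 0 < S.card by lia] using congrArg Subtype.val hgw

namespace SimpleGraph

variable {V : Type*}

/-- A tree has a 3-connected augmentation by new edges of which two end in each leaf, one in each
vertex of degree two and none in the other vertices. -/
def HasAugmentation [Fintype V] (T : SimpleGraph V) [DecidableRel T.Adj] : Prop :=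
  ∃ F : SimpleGraph V,
    (∀ a b : V, F.Adj a b → ¬ T.Adj a b) ∧
    KConnected (T ⊔ F) 3 ∧
    2 * F.edgeSet.ncard =
      2 * (Finset.univ.filter fun v : V => T.degree v = 1).card
        + (Finset.univ.filter fun v : V => T.degree v = 2).card ∧
    (∀ v : V, T.degree v = 1 → (F.neighborSet v).ncard = 2) ∧
    (∀ v : V, T.degree v = 2 → (F.neighborSet v).ncard = 1) ∧
    (∀ v : V, 3 ≤ T.degree v → (F.neighborSet v).ncard = 0)

variable {T : SimpleGraph V} {l d : ℕ → V}

/-- Turns a relation on the indices of the leaves `l 0, …, l (k - 1)` and the vertices of degree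
two `d 0, …, d (n - 1)`, the latter shifted by `k`, into an augmenting set of edges. -/
theorem IsTree.hasAugmentation_of_rel [Fintype V] [DecidableRel T.Adj]
    (hT : T.IsTree) {k n : ℕ} (hn : 3 ≤ Fintype.card V)
    (hl : Set.BijOn l {i | i < k} {v | T.degree v = 1})
    (hd : Set.BijOn d {i | i < n} {v | T.degree v = 2}) {R : ℕ → ℕ → Prop}
    (hR : ∀ i j, R i j → R j i) (hR' : ∀ i < k + n, ¬ R i i)
    (hR2 : ∀ i < k, {j | j < k + n ∧ R i j}.ncard = 2)
    (hR1 : ∀ i < n, {j | j < k + n ∧ R (k + i) j}.ncard = 1)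
    (hld : ∀ i < k, ∀ j < n, R i (k + j) → ¬ T.Adj (l i) (d j))
    (hdd : ∀ i < n, ∀ j < n, R (k + i) (k + j) → ¬ T.Adj (d i) (d j))
    (hconn : ∀ F : SimpleGraph V, (∀ i < k, ∀ j < k, R i j → F.Adj (l i) (l j)) →
      (∀ i < k, ∀ j < n, R i (k + j) → F.Adj (l i) (d j)) →
      (∀ i < n, ∀ j < n, R (k + i) (k + j) → F.Adj (d i) (d j)) → KConnected (T ⊔ F) 3) :
    T.HasAugmentation := by
  let g : ℕ → V := fun i => if i < k then l i else d (i - k)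
  have hgl : ∀ i < k, g i = l i := fun i hi => if_pos hi
  have hgd : ∀ i, g (k + i) = d i := fun i => by simp [g]
  have hcases : ∀ i < k + n, i < k ∨ ∃ j < n, i = k + j := fun i hi => by
    by_cases h : i < k
    · exact .inl h
    · exact .inr ⟨i - k, by lia, by lia⟩
  have hl1 : ∀ i < k, T.degree (l i) = 1 := fun i hi => hl.mapsTo hi
  have hd2 : ∀ i < n, T.degree (d i) = 2 := fun i hi => hd.mapsTo hi
  have hne : ∀ i < k, ∀ j < n, l i ≠ d j := fun i hi j hj h => by
    have h1 := hl1 i hi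
    have h2 := hd2 j hj
    rw [h] at h1
    lia
  have hg : Set.InjOn g {i | i < k + n} := by
    intro i hi j hj hij
    rcases hcases i hi with hi' | ⟨i, hi', rfl⟩ <;> rcases hcases j hj with hj' | ⟨j, hj', rfl⟩
    · rw [hgl i hi', hgl j hj'] at hij
      exact hl.injOn hi' hj' hij
    · rw [hgl i hi', hgd] at hij
      exact absurd hij (hne i hi' j hj')
    · rw [hgl j hj', hgd] at hij
      exact absurd hij.symm (hne j hj' i hi')
    · rw [hgd, hgd] at hij
      rw [hd.injOn hi' hj' hij]
  let F := ofIndex g (k + n) R hg hR hR'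
  have hF : ∀ i < k + n, ∀ j < k + n, R i j → F.Adj (g i) (g j) := fun i hi j hj h =>
    (ofIndex_adj_iff hi hj).2 h
  have h1 : ∀ v : V, T.degree v = 1 → (F.neighborSet v).ncard = 2 := by
    intro v hv
    obtain ⟨i, hi, rfl⟩ := hl.surjOn hv
    rw [← hgl i hi, ncard_neighborSet_ofIndex (Nat.lt_add_right n hi), hR2 i hi]
  have h2 : ∀ v : V, T.degree v = 2 → (F.neighborSet v).ncard = 1 := by
    intro v hv
    obtain ⟨i, hi, rfl⟩ := hd.surjOn hv
    rw [← hgd i, ncard_neighborSet_ofIndex (Nat.add_lt_add_left hi k), hR1 i hi]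
  have h3 : ∀ v : V, T.degree v ≠ 1 → T.degree v ≠ 2 → (F.neighborSet v).ncard = 0 := by
    intro v hv hv'
    rw [neighborSet_ofIndex_eq_empty, Set.ncard_empty]
    intro i hi h
    rcases hcases i hi with hi' | ⟨i, hi', rfl⟩
    · rw [hgl i hi'] at h
      exact hv (h ▸ hl1 i hi')
    · rw [hgd] at h
      exact hv' (h ▸ hd2 i hi')
  refine ⟨F, ?_, hconn F ?_ ?_ ?_, ?_, h1, h2, fun v hv => h3 v (by lia) (by lia)⟩
  · rintro _ _ ⟨i, hi, j, hj, rfl, rfl, hij⟩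
    rcases hcases i hi with hi' | ⟨i, hi', rfl⟩ <;> rcases hcases j hj with hj' | ⟨j, hj', rfl⟩
    · rw [hgl i hi', hgl j hj']
      exact hT.not_adj_of_degree_eq_one hn (hl1 i hi') (hl1 j hj')
    · rw [hgl i hi', hgd]
      exact hld i hi' j hj' hij
    · rw [hgl j hj', hgd, T.adj_comm]
      exact hld j hj' i hi' (hR _ _ hij)
    · rw [hgd, hgd]
      exact hdd i hi' j hj' hij
  · intro i hi j hj h
    rw [← hgl i hi, ← hgl j hj]
    exact hF i (by lia) j (by lia) h
  · intro i hi j hj h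
    rw [← hgl i hi, ← hgd j]
    exact hF i (by lia) _ (by lia) h
  · intro i hi j hj h
    rw [← hgd i, ← hgd j]
    exact hF _ (by lia) _ (by lia) h
  · rw [two_mul_ncard_edgeSet, Finset.card_filter, Finset.card_filter, Finset.mul_sum,
      ← Finset.sum_add_distrib]
    refine Finset.sum_congr rfl fun v _ => ?_
    by_cases hv : T.degree v = 1
    · simp [h1 v hv, hv]
    · by_cases hv' : T.degree v = 2
      · simp [h2 v hv', hv']
      · simp [h3 v hv hv', hv, hv']

variable [DecidableEq V]

/-- In an enumeration of the vertices of degree two in which adjacent ones are consecutive, a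
vertex in or next to `A` has an index in or next to the indices of `A`. -/
theorem exists_succ_of_adj {D : Finset V} (hd : Set.BijOn d {i | i < D.card} D)
    (hadj : ∀ i < D.card, ∀ j < D.card, T.Adj (d i) (d j) → j = i + 1 ∨ i = j + 1)
    {A X : Finset V} (hAD : (A : Set V) ⊆ D) (hX : ∀ x ∈ X, ∃ a ∈ A, T.Adj a x) {j : ℕ}
    (hj : j < D.card) (hjX : d j ∈ A ∪ X) :
    ∃ i < D.card, d i ∈ A ∧ (i = j ∨ j = i + 1 ∨ i = j + 1) := by
  rcases Finset.mem_union.1 hjX with h | h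
  · exact ⟨j, hj, h, .inl rfl⟩
  · obtain ⟨a, ha, haj⟩ := hX _ h
    obtain ⟨i, hi, rfl⟩ := hd.surjOn (hAD ha)
    exact ⟨i, hi, ha, .inr (hadj i hi j hj haj)⟩

/-- If no edge of the antipodal matching on the vertices of degree two joins a connected set `A` of
them to the outside of `A ∪ X`, where `X` consists of neighbors of `A`, then they induce a connected
subgraph. -/
theorem preconnected_induce_of_antipodal {D : Finset V} {m : ℕ} (hDm : D.card = m + m)
    (hd : Set.BijOn d {i | i < D.card} D)
    (hadj : ∀ i < D.card, ∀ j < D.card, T.Adj (d i) (d j) → j = i + 1 ∨ i = j + 1)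
    {A X : Finset V} (hA : A.Nonempty) (hAD : (A : Set V) ⊆ D)
    (hAc : (T.induce (A : Set V)).Preconnected) (hX : ∀ x ∈ X, ∃ a ∈ A, T.Adj a x)
    (hmate : ∀ i < m, (d i ∈ A → d (i + m) ∈ A ∪ X) ∧ (d (i + m) ∈ A → d i ∈ A ∪ X)) :
    (T.induce (D : Set V)).Preconnected := by
  have hbetween : ∀ i j h, i ≤ j → j ≤ h → h < D.card → d i ∈ A → d h ∈ A → d j ∈ A :=
    fun i j h hij hjh hh hi hhA => hAc.mem_of_le_of_le hd hadj hAD hij hjh hh hi hhA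
  have hwide : ∀ i j h, i ≤ j → j ≤ h → h < D.card → d i ∈ A ∪ X → d h ∈ A ∪ X →
      d j ∈ A ∪ X := by
    intro i j h hij hjh hh hi hhA
    by_cases h1 : j = i
    · rwa [h1]
    by_cases h2 : j = h
    · rwa [h2]
    obtain ⟨i', hi', hi'A, hii⟩ := exists_succ_of_adj hd hadj hAD hX (by lia) hi
    obtain ⟨h', hh', hh'A, hhh⟩ := exists_succ_of_adj hd hadj hAD hX hh hhA
    exact Finset.mem_union_left _ (hbetween i' j h' (by lia) (by lia) hh' hi'A hh'A)
  obtain ⟨p, hpm, hp⟩ : ∃ p < m, (d p ∈ A ∧ d (p + m) ∈ A ∪ X) ∨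
      (d p ∈ A ∪ X ∧ d (p + m) ∈ A) := by
    obtain ⟨a, ha⟩ := hA
    obtain ⟨i, hi, rfl⟩ := hd.surjOn (hAD ha)
    have hi' : i < D.card := hi
    by_cases h : i < m
    · exact ⟨i, h, .inl ⟨ha, (hmate i h).1 ha⟩⟩
    · have h' : i - m + m = i := by lia
      exact ⟨i - m, by lia, .inr ⟨(hmate (i - m) (by lia)).2 (by rwa [h']), by rwa [h']⟩⟩
  have hend : d 0 ∈ A ∪ X ∧ d (m - 1 + m) ∈ A ∪ X := by
    have hzero : d m ∈ A → d 0 ∈ A ∪ X := fun h =>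
      (hmate 0 (by lia)).2 (by rwa [Nat.zero_add])
    rcases hp with ⟨h1, h2⟩ | ⟨h1, h2⟩
    · obtain ⟨c, hc, hcA, hcp⟩ := exists_succ_of_adj hd hadj hAD hX (by lia) h2
      refine ⟨?_, (hmate (m - 1) (by lia)).1 (hbetween p _ c (by lia) (by lia) hc h1 hcA)⟩
      rcases Nat.eq_zero_or_pos p with rfl | hp0
      · exact Finset.mem_union_left _ h1
      · exact hzero (hbetween p _ c (by lia) (by lia) hc h1 hcA)
    · obtain ⟨c, hc, hcA, hcp⟩ := exists_succ_of_adj hd hadj hAD hX (by lia) h1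
      refine ⟨hzero (hbetween c _ (p + m) (by lia) (by lia) (by lia) hcA h2), ?_⟩
      by_cases hpm' : p = m - 1
      · exact Finset.mem_union_left _ (hpm' ▸ h2)
      · exact (hmate (m - 1) (by lia)).1 (hbetween c _ (p + m) (by lia) (by lia) (by lia) hcA h2)
  have hall : ∀ v ∈ D, v ∈ A ∪ X := by
    intro v hv
    obtain ⟨i, hi, rfl⟩ := hd.surjOn hv
    have hi' : i < D.card := hi
    exact hwide 0 i (m - 1 + m) (by lia) (by lia) (by lia) hend.1 hend.2
  refine preconnected_induce_of_propagate fun P hP x hx y hy hPx => ?_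
  have hnear : ∀ v ∈ D, ∃ a ∈ A, P a ↔ P v := by
    intro v hv
    rcases Finset.mem_union.1 (hall v hv) with h | h
    · exact ⟨v, h, .rfl⟩
    · obtain ⟨a, ha, hav⟩ := hX v h
      exact ⟨a, ha, hP a (hAD ha) v hv hav⟩
  obtain ⟨a, ha, hax⟩ := hnear x hx
  obtain ⟨b, hb, hby⟩ := hnear y hy
  exact hby.1 (hAc.induce_propagate
    (fun u hu v hv huv => (hP u (hAD hu) v (hAD hv) huv).1) ha hb (hax.2 hPx))

end SimpleGraph

namespace SimpleGraph

variable {V : Type*} [Fintype V] [DecidableEq V] {T : SimpleGraph V} [DecidableRel T.Adj]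
  {D : Finset V} {d : ℕ → V} {m : ℕ}

/-- If the vertices of degree two do not form a thread, one can add a cycle through the leaves and
the antipodal matching on the vertices of degree two. -/
theorem IsTree.hasAugmentation_of_not_preconnected (hT : T.IsTree) (hn : 4 ≤ Fintype.card V)
    (hdD : Set.BijOn d {i | i < D.card} D) (hD : ∀ v, v ∈ D ↔ T.degree v = 2)
    (hadj : ∀ i < D.card, ∀ j < D.card, T.Adj (d i) (d j) → j = i + 1 ∨ i = j + 1)
    (hDm : D.card = m + m) (hthread : ¬ (D.Nonempty ∧ (T.induce (D : Set V)).Preconnected)) :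
    T.HasAugmentation := by
  set L : Finset V := Finset.univ.filter fun v => T.degree v = 1 with hL
  set k := L.card with hk
  have hk3 : 3 ≤ k := by
    by_contra! h
    have hcompl : ∀ v, v ∈ Finset.univ \ L ↔ T.degree v ≠ 1 := by simp [hL]
    have hne : (Finset.univ \ L).Nonempty := by
      rw [← Finset.card_pos, Finset.card_univ_sdiff]
      lia
    obtain ⟨h1, -, h2⟩ := hT.of_leafless_of_separator_card_le_two hne
      Finset.sdiff_disjoint (show L.card ≤ 2 by lia) (fun a ha => by
        have := hT.degree_pos (by lia) a
        have := (hcompl a).1 ha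
        lia) (by simp)
    have hDL : Finset.univ \ L = D := by
      ext v
      refine ⟨fun hv => (hD v).2 (h1 v hv), fun hv => (hcompl v).2 ?_⟩
      rw [(hD v).1 hv]
      decide
    exact hthread ⟨hDL ▸ hne, hDL ▸ h2⟩
  obtain ⟨a, ha, b, hb, hab⟩ := Finset.one_lt_card.1 (show 1 < L.card by lia)
  obtain ⟨l, hl, -, -⟩ := Finset.exists_bijOn_first_last ha hb hab
  have hLc : (L : Set V) = {v | T.degree v = 1} := by ext; simp [hL]
  have hDc : (D : Set V) = {v | T.degree v = 2} := by ext; simp [hD]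
  rw [hLc] at hl
  have hdD' := hdD
  rw [hDc] at hdD'
  refine hT.hasAugmentation_of_rel (by lia) hl hdD'
    (R := fun i j => (i < k ∧ j < k ∧
      (j = i + 1 ∨ i = j + 1 ∨ (i = 0 ∧ j + 1 = k) ∨ (j = 0 ∧ i + 1 = k))) ∨
      (k ≤ i ∧ k ≤ j ∧ (j = i + m ∨ i = j + m))) (by lia) (by lia) ?_ ?_ (by lia) ?_ ?_
  · intro i hi
    rw [Set.ncard_eq_two]
    refine ⟨if i = 0 then k - 1 else i - 1, if i + 1 = k then 0 else i + 1, by grind, ?_⟩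
    ext j
    simp only [Set.mem_ofPred_eq, Set.mem_insert_iff, Set.mem_singleton_iff]
    split_ifs <;> lia
  · intro i hi
    rw [Set.ncard_eq_one]
    refine ⟨if i < m then k + i + m else k + i - m, ?_⟩
    ext j
    simp only [Set.mem_ofPred_eq, Set.mem_singleton_iff]
    split_ifs <;> lia
  · intro i hi j hj hij hij'
    have hm : m = 1 := by
      have := hadj i hi j hj hij'
      lia
    refine hthread ⟨⟨d i, hdD.mapsTo hi⟩, preconnected_induce_of_propagate
      fun P hP x hx y hy hPx => ?_⟩
    obtain ⟨a, ha, rfl⟩ := hdD.surjOn hx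
    obtain ⟨b, hb, rfl⟩ := hdD.surjOn hy
    have ha' : a < D.card := ha
    have hb' : b < D.card := hb
    have h1 := hP _ (hdD.mapsTo hi) _ (hdD.mapsTo hj) hij'
    have hP' : ∀ c < D.card, P (d c) ↔ P (d i) := fun c hc => by
      rcases (show c = i ∨ c = j by lia) with h | h
      · rw [h]
      · rw [h, h1]
    exact (hP' b hb').2 ((hP' a ha').1 hPx)
  · intro F hll _ hdd
    refine hT.kConnected_three_of_le le_sup_left hn hl
      (fun i hi => .inr (hll _ (by lia) _ hi (by lia))) ?_ ?_
    · intro X _ _ h0 hk1 P hP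
      exact hP _ h0 _ hk1 (.inr (hll _ (by lia) _ (by lia) (by lia)))
    · intro A X hA _ hdeg _ hAc hXA _
      have hAD : (A : Set V) ⊆ D := fun a ha => (hD a).2 (hdeg a ha)
      by_contra! hout
      have hclosed : ∀ a ∈ A, ∀ b, F.Adj a b → b ∈ A ∪ X := fun a ha b hab => by
        by_contra hb
        exact hout a ha b hb (.inr hab)
      refine hthread ⟨hA.mono hAD, preconnected_induce_of_antipodal hDm hdD hadj hA hAD hAc hXA
        fun i hi => ⟨fun h => hclosed _ h _ (hdd _ (by lia) _ (by lia) (by lia)),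
          fun h => hclosed _ h _ (hdd _ (by lia) _ (by lia) (by lia))⟩⟩

/-- If the vertices of degree two form a thread, one can add a path through the leaves, two edges
from its ends to the middle of the thread, and a matching on the rest of the thread. -/
theorem IsTree.hasAugmentation_of_preconnected (hT : T.IsTree) (hn : 4 ≤ Fintype.card V)
    (hdD : Set.BijOn d {i | i < D.card} D) (hD : ∀ v, v ∈ D ↔ T.degree v = 2)
    (hadj : ∀ i < D.card, ∀ j < D.card, T.Adj (d i) (d j) → j = i + 1 ∨ i = j + 1)
    (hDm : D.card = m + m) (hm : 0 < m) (hDc : (T.induce (D : Set V)).Preconnected) :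
    T.HasAugmentation := by
  have hmem : ∀ i < D.card, d i ∈ D := fun i hi => hdD.mapsTo hi
  have hdeg2 : ∀ i < D.card, T.degree (d i) = 2 := fun i hi => (hD _).1 (hmem i hi)
  have hinj : ∀ i < D.card, ∀ j < D.card, d i = d j → i = j := fun i hi j hj h =>
    hdD.injOn hi hj h
  have hsucc : ∀ i, i + 1 < D.card → T.Adj (d i) (d (i + 1)) := fun i hi =>
    hDc.adj_succ hdD hadj hi
  obtain ⟨W, x, hxW, hx, h0W, hW, hWd, hWcross⟩ :=
    hT.exists_leaf_side hdD.injOn (by lia) hsucc (hdeg2 0 (by lia))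
  obtain ⟨U, y, hyU, hy, h0U, hU, hUd, hUcross⟩ :=
    hT.exists_leaf_side (d := fun i => d (D.card - 1 - i)) (n := D.card)
      (fun i hi j hj hij => by
        have hi' : i < D.card := hi
        have hj' : j < D.card := hj
        have := hinj _ (by lia) _ (by lia) hij
        lia)
      (by lia) (fun i hi => by
        have := hsucc (D.card - 1 - (i + 1)) (by lia)
        rw [show D.card - 1 - (i + 1) + 1 = D.card - 1 - i by lia] at this
        exact this.symm) (hdeg2 _ (by lia))
  replace hUd : ∀ i < D.card, d i ∈ U → i = D.card - 1 := fun i hi hiU => by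
    have := hUd (D.card - 1 - i) (by lia)
      (by rwa [show D.card - 1 - (D.card - 1 - i) = i by lia])
    lia
  simp only [Nat.sub_zero] at h0U hUcross
  have hxy : x ≠ y := by
    rintro rfl
    have := hU.induce_propagate (P := (· ∈ W)) (by
      intro u hu v _ huv huW
      by_contra hvW
      have := hUd 0 (by lia) ((hWcross u v huv huW hvW).1 ▸ hu)
      lia) hyU h0U hxW
    have := hWd _ (by lia) this
    lia
  set L : Finset V := Finset.univ.filter fun v => T.degree v = 1 with hL
  set k := L.card with hk
  have hk2 : 2 ≤ k := Finset.one_lt_card.2 ⟨x, by simp [hL, hx], y, by simp [hL, hy], hxy⟩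
  obtain ⟨l, hl, hl0, hlk⟩ := Finset.exists_bijOn_first_last (S := L) (a := x) (b := y)
    (by simp [hL, hx]) (by simp [hL, hy]) hxy
  have hLset : (L : Set V) = {v | T.degree v = 1} := by ext; simp [hL]
  have hDset : (D : Set V) = {v | T.degree v = 2} := by ext; simp [hD]
  rw [hLset] at hl
  have hdD' := hdD
  rw [hDset] at hdD'
  have hxd : ∀ i < D.card, T.Adj x (d i) → i = 0 := fun i hi h => by
    by_contra hi0
    have hxd0 := (hWcross _ _ h hxW fun h => hi0 (hWd i hi h)).1
    have := hdeg2 0 (by lia)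
    rw [← hxd0] at this
    lia
  have hyd : ∀ i < D.card, T.Adj y (d i) → i = D.card - 1 := fun i hi h => by
    by_contra hi0
    have hyd0 := (hUcross _ _ h hyU fun h => hi0 (hUd i hi h)).1
    have := hdeg2 (D.card - 1) (by lia)
    rw [← hyd0] at this
    lia
  refine hT.hasAugmentation_of_rel (by lia) hl hdD'
    (R := fun i j => ((j = i + 1 ∧ j < k) ∨ (i = 0 ∧ j = k + m) ∨ (i + 1 = k ∧ j + 1 = k + m) ∨
        (k ≤ i ∧ j = i + m + 1)) ∨
      ((i = j + 1 ∧ i < k) ∨ (j = 0 ∧ i = k + m) ∨ (j + 1 = k ∧ i + 1 = k + m) ∨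
        (k ≤ j ∧ i = j + m + 1))) (by lia) (by lia) ?_ ?_ ?_ ?_ ?_
  · intro i hi
    rw [Set.ncard_eq_two]
    refine ⟨if i = 0 then k + m else i - 1, if i + 1 = k then k + m - 1 else i + 1, by grind, ?_⟩
    ext j
    simp only [Set.mem_ofPred_eq, Set.mem_insert_iff, Set.mem_singleton_iff]
    split_ifs <;> lia
  · intro i hi
    rw [Set.ncard_eq_one]
    refine ⟨if i = m then 0 else if i + 1 = m then k - 1 else if i < m then k + i + m + 1 else
      k + i - m - 1, ?_⟩
    ext j
    simp only [Set.mem_ofPred_eq, Set.mem_singleton_iff]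
    split_ifs <;> lia
  · intro i hi j hj hij h
    rcases (show (i = 0 ∧ j = m) ∨ (i = k - 1 ∧ j + 1 = m) by lia) with ⟨rfl, rfl⟩ | ⟨rfl, rfl⟩
    · have := hxd _ hj (hl0 ▸ h)
      lia
    · have := hyd _ hj (hlk ▸ h)
      lia
  · intro i hi j hj hij h
    have := hadj i hi j hj h
    lia
  intro F hll hld hdd
  have hxF : F.Adj x (d m) := hl0 ▸ hld 0 (by lia) m (by lia) (by lia)
  have hyF : F.Adj y (d (m - 1)) := hlk ▸ hld (k - 1) (by lia) (m - 1) (by lia) (by lia)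
  refine hT.kConnected_three_of_le le_sup_left hn hl
    (fun i hi => .inr (hll _ (by lia) _ hi (by lia))) ?_ ?_
  · rintro X hX ⟨j, hj0, hjk, hjX⟩ h0 h1 P hP
    rw [hl0] at h0 ⊢
    rw [hlk] at h1 ⊢
    have hj1 : T.degree (l j) = 1 := hl.mapsTo (show j < k by lia)
    have hside : ∀ W : Set V, (T.induce W).Preconnected → (∀ v ∈ W, v ∈ X → v = l j) →
        ∀ u ∈ W, ∀ v ∈ W, u ∉ X → v ∉ X → (P u ↔ P v) := by
      intro W hW hWX u hu v hv huX hvX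
      have hWX' : ∀ z ∈ W \ {l j}, z ∉ X := fun z hz hzX => hz.2 (hWX z hz.1 hzX)
      have hne : ∀ z, z ∉ X → z ≠ l j := fun z hz h => hz (h ▸ hjX)
      exact (hW.induce_diff_of_degree_eq_one hj1).induce_propagate (P := fun z => P u ↔ P z)
        (fun a ha b hb hab h => h.trans (hP a (hWX' a ha) b (hWX' b hb) (.inl hab)))
        ⟨hu, hne u huX⟩ ⟨hv, hne v hvX⟩ .rfl
    by_cases hc : ∃ c < D.card, d c ∈ X
    · obtain ⟨c, hc, hcX⟩ := hc
      have hne : d c ≠ l j := fun h => by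
        have := hdeg2 c hc
        rw [h] at this
        lia
      have honly : ∀ v ∈ X, v = d c ∨ v = l j := by
        intro v hv
        by_contra! h
        have h3 := Finset.card_le_card (show {v, d c, l j} ⊆ X by
          simp [Finset.insert_subset_iff, hv, hcX, hjX])
        rw [Finset.card_eq_three.2 ⟨v, d c, l j, h.1, h.2, hne, rfl⟩] at h3
        lia
      have hdX : ∀ i < D.card, i ≠ c → d i ∉ X := fun i hi hic h => by
        rcases honly _ h with h | h
        · exact hic (hinj i hi c hc h)
        · have := hdeg2 i hi
          rw [h] at this
          lia
      have hseg : ∀ a b, a ≤ b → b < D.card → (b < c ∨ c < a) → (P (d a) ↔ P (d b)) := by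
        intro a b hab
        induction b, hab using Nat.le_induction with
        | base => simp
        | succ b hab ih =>
          intro hb hbc
          rw [ih (by lia) (by lia)]
          exact hP _ (hdX b (by lia) (by lia)) _ (hdX _ hb (by lia)) (.inl (hsucc b hb))
      by_cases hcm : m ≤ c
      · rw [hside W hW (fun v hv hvX => (honly v hvX).resolve_left (by
            rintro rfl
            have := hWd c hc hv
            lia)) x hxW (d 0) h0W h0 (hdX _ (by lia) (by lia)),
          hseg 0 (m - 1) (by lia) (by lia) (by lia)]
        exact hP _ (hdX _ (by lia) (by lia)) _ h1 (.inr hyF.symm)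
      · rw [hside U hU (fun v hv hvX => (honly v hvX).resolve_left (by
            rintro rfl
            have := hUd c hc hv
            lia)) y hyU _ h0U h1 (hdX _ (by lia) (by lia)),
          ← hseg m (D.card - 1) (by lia) (by lia) (by lia)]
        exact hP _ h0 _ (hdX _ (by lia) (by lia)) (.inr hxF)
    · push Not at hc
      rw [hP _ h0 _ (hc m (by lia)) (.inr hxF), hP _ h1 _ (hc (m - 1) (by lia)) (.inr hyF)]
      refine hside D hDc (fun v hv hvX => ?_) _ (hmem _ (by lia)) _ (hmem _ (by lia))
        (hc _ (by lia)) (hc _ (by lia))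
      obtain ⟨i, hi, rfl⟩ := hdD.surjOn hv
      exact absurd hvX (hc i hi)
  · rintro A X ⟨a, ha⟩ _ hdeg hX hAc hXA ⟨z, hzX, hz⟩
    have hAD : (A : Set V) ⊆ D := fun a ha => (hD a).2 (hdeg a ha)
    by_contra! hout
    have hclosed : ∀ a ∈ A, ∀ b, F.Adj a b → b ∈ A ∪ X := fun a ha b hab => by
      by_contra hb
      exact hout a ha b hb (.inr hab)
    have hbetween : ∀ i j h, i ≤ j → j ≤ h → h < D.card → d i ∈ A → d h ∈ A → d j ∈ A :=
      fun i j h hij hjh hh hi hhA => hAc.mem_of_le_of_le hdD hadj hAD hij hjh hh hi hhA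
    have hleaf : ∀ v, T.degree v = 1 → v ∈ A ∪ X → v ∈ X := fun v hv hvA => by
      refine (Finset.mem_union.1 hvA).resolve_left fun h => ?_
      have := hdeg v h
      lia
    have hxX : d m ∈ A → x ∈ X := fun h => hleaf x hx (hclosed _ h _ hxF.symm)
    have hyX : d (m - 1) ∈ A → y ∈ X := fun h => hleaf y hy (hclosed _ h _ hyF.symm)
    have hmid : d m ∈ A → d (m - 1) ∈ A := fun h => by
      obtain ⟨b, hb, hbx⟩ := hXA x (hxX h)
      obtain ⟨i, hi, rfl⟩ := hdD.surjOn (hAD hb)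
      have hi0 := hxd i hi hbx.symm
      exact hbetween i _ m (by lia) (by lia) (by lia) hb h
    have hmid' : d (m - 1) ∈ A → d m ∈ A := fun h => by
      obtain ⟨b, hb, hby⟩ := hXA y (hyX h)
      obtain ⟨i, hi, rfl⟩ := hdD.surjOn (hAD hb)
      have hi0 := hyd i hi hby.symm
      exact hbetween (m - 1) _ i (by lia) (by lia) hi h hb
    have hm : d m ∉ A := fun h => by
      have h3 := Finset.card_le_card (show {x, y, z} ⊆ X by
        simp [Finset.insert_subset_iff, hxX h, hyX (hmid h), hzX])
      rw [Finset.card_eq_three.2 ⟨x, y, z, hxy, fun h => hz (h ▸ hx), fun h => hz (h ▸ hy), rfl⟩]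
        at h3
      lia
    have hm' : d (m - 1) ∉ A := fun h => hm (hmid' h)
    obtain ⟨i, hi, rfl⟩ := hdD.surjOn (hAD ha)
    have hi' : i < D.card := hi
    have him : i ≠ m := by
      rintro rfl
      exact hm ha
    have him' : i ≠ m - 1 := by
      rintro rfl
      exact hm' ha
    by_cases h : i < m
    · obtain ⟨c, hc, hcA, hci⟩ := exists_succ_of_adj hdD hadj hAD hXA
        (show i + m + 1 < D.card by lia) (hclosed _ ha _ (hdd _ (by lia) _ (by lia) (by lia)))
      exact hm (hbetween i _ c (by lia) (by lia) hc ha hcA)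
    · obtain ⟨c, hc, hcA, hci⟩ := exists_succ_of_adj hdD hadj hAD hXA
        (show i - m - 1 < D.card by lia) (hclosed _ ha _ (hdd _ (by lia) _ (by lia) (by lia)))
      exact hm (hbetween c _ i (by lia) (by lia) hi hcA ha)

end SimpleGraph

/-- Let `T` be a tree on `n ≥ 4` vertices with an even number `n₂(T)` of degree-2
vertices. Then there is a set `F` of new edges (none parallel to an edge of `T`) with
`2·|F| = 2·n₁(T) + n₂(T)` (i.e. `|F| = ⌈(2n₁(T)+n₂(T))/2⌉ = n₁(T) + n₂(T)/2`) such that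
`T ⊔ F` is 3-connected, every leaf of `T` is incident to exactly two edges of `F`,
every degree-2 vertex of `T` to exactly one, and all other vertices to none. -/
theorem stmt16 {V : Type*} [Fintype V] [DecidableEq V] (T : SimpleGraph V)
    [DecidableRel T.Adj] (hT : T.IsTree) (hn : 4 ≤ Fintype.card V)
    (heven : Even (Finset.univ.filter fun v : V => T.degree v = 2).card) :
    ∃ F : SimpleGraph V,
      (∀ a b : V, F.Adj a b → ¬ T.Adj a b) ∧
      KConnected (T ⊔ F) 3 ∧
      2 * F.edgeSet.ncard =
        2 * (Finset.univ.filter fun v : V => T.degree v = 1).card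
          + (Finset.univ.filter fun v : V => T.degree v = 2).card ∧
      (∀ v : V, T.degree v = 1 → (F.neighborSet v).ncard = 2) ∧
      (∀ v : V, T.degree v = 2 → (F.neighborSet v).ncard = 1) ∧
      (∀ v : V, 3 ≤ T.degree v → (F.neighborSet v).ncard = 0) := by
  set D := Finset.univ.filter fun v : V => T.degree v = 2 with hD
  have hD' : ∀ v, v ∈ D ↔ T.degree v = 2 := by simp [hD]
  obtain ⟨d, hd, hadj⟩ := hT.exists_enum_of_degree_eq_two fun v hv => (hD' v).1 hv
  obtain ⟨m, hm⟩ := heven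
  by_cases h : D.Nonempty ∧ (T.induce (D : Set V)).Preconnected
  · have := h.1.card_pos
    exact hT.hasAugmentation_of_preconnected hn hd hD' hadj hm (by lia) h.2
  · exact hT.hasAugmentation_of_not_preconnected hn hd hD' hadj hm h
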